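/- arXiv:2005.08609 — 2 statements merged into one kernel-verified Lean document; each statement's English description precedes it below -/
import Mathlib

section
/- Let G be a finite DAG with n nodes and maximum indegree Δ, and let R ≥ Δ + 1. In the oneshot model, every valid pebbling of G with R red pebbles that has minimum cost among all such pebblings consists of at most (2Δ + 3)·n moves. (Specifically: it contains at most n moves of type (3), at most n moves of type (4), and at most (2Δ + 1)·n moves of types (1) and (2).) -/
namespace RBPebble

open scoped Classical

/-- A pebble is either red (fast memory) or blue (slow memory). -/
inductive Peb : Type
  | red
  | blue
  deriving DecidableEq

/-- The four kinds of moves of a red-blue pebbling. -/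
inductive Move (V : Type) : Type
  | toRed (v : V)    -- (1) replace a blue pebble by a red pebble
  | toBlue (v : V)   -- (2) replace a red pebble by a blue pebble
  | compute (v : V)  -- (3) place a red pebble on a node whose in-neighbors are all red
  | delete (v : V)   -- (4) delete a pebble
  deriving DecidableEq

variable {V : Type}

/-- A configuration assigns to each node no pebble, a red pebble, or a blue pebble. -/
def Config (V : Type) : Type := V → Option Peb

/-- The initial configuration: no pebbles anywhere. -/
def initConfig : Config V := fun _ => none

/-- The effect of a move on a configuration. -/
def applyMove [DecidableEq V] (c : Config V) : Move V → Config V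
  | .toRed v => Function.update c v (some Peb.red)
  | .toBlue v => Function.update c v (some Peb.blue)
  | .compute v => Function.update c v (some Peb.red)
  | .delete v => Function.update c v none

/-- The number of red pebbles in a configuration. -/
noncomputable def redCount [Fintype V] (c : Config V) : ℕ :=
  (Finset.univ.filter fun v => c v = some Peb.red).card

/-- Legality of a move in a given configuration (base model). -/
def legalMove (edge : V → V → Prop) (c : Config V) : Move V → Prop
  | .toRed v => c v = some Peb.blue
  | .toBlue v => c v = some Peb.red
  | .compute v => ∀ u, edge u v → c u = some Peb.red
  | .delete v => c v ≠ none

/-- A sequence of moves is valid from a configuration: every move is legal and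
at every point at most `R` red pebbles are on the graph. -/
def ValidFrom [Fintype V] [DecidableEq V] (edge : V → V → Prop) (R : ℕ) :
    Config V → List (Move V) → Prop
  | _, [] => True
  | c, m :: ms =>
      legalMove edge c m ∧ redCount (applyMove c m) ≤ R ∧
        ValidFrom edge R (applyMove c m) ms

/-- Running a list of moves from a configuration. -/
def runMoves [DecidableEq V] (c : Config V) : List (Move V) → Config V
  | [] => c
  | m :: ms => runMoves (applyMove c m) ms

/-- A sink: a node with no outgoing edge. -/
def IsSink (edge : V → V → Prop) (v : V) : Prop := ∀ u, ¬ edge v u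

/-- A source: a node with no incoming edge. -/
def IsSource (edge : V → V → Prop) (v : V) : Prop := ∀ u, ¬ edge u v

/-- A valid pebbling of the DAG with `R` red pebbles: starts from the empty
configuration, is valid throughout, and in the final configuration every sink
carries a pebble (of either color). -/
def IsPebbling [Fintype V] [DecidableEq V] (edge : V → V → Prop) (R : ℕ)
    (moves : List (Move V)) : Prop :=
  ValidFrom edge R initConfig moves ∧
    ∀ v, IsSink edge v → runMoves initConfig moves v ≠ none

def isTransfer : Move V → Bool
  | .toRed _ => true
  | .toBlue _ => true
  | _ => false

def isCompute : Move V → Bool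
  | .compute _ => true
  | _ => false

def isDelete : Move V → Bool
  | .delete _ => true
  | _ => false

/-- The cost of a pebbling: the number of moves of types (1) and (2). -/
def cost (moves : List (Move V)) : ℕ := (moves.filter isTransfer).length

/-- The number of compute moves (type (3)). -/
def computeCount (moves : List (Move V)) : ℕ := (moves.filter isCompute).length

/-- The number of delete moves (type (4)). -/
def deleteCount (moves : List (Move V)) : ℕ := (moves.filter isDelete).length

/-- The cost in the compcost model: transfers plus `ε` times the computes. -/
noncomputable def ccCost (ε : ℝ) (moves : List (Move V)) : ℝ :=
  (cost moves : ℝ) + ε * (computeCount moves : ℝ)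

/-- The oneshot restriction: each node is computed at most once. -/
def Oneshot [DecidableEq V] (moves : List (Move V)) : Prop :=
  ∀ v : V, moves.count (Move.compute v) ≤ 1

/-- The nodel restriction: no delete moves are used. -/
def NoDel (moves : List (Move V)) : Prop := ∀ m ∈ moves, isDelete m = false

/-- The indegree of a node. -/
noncomputable def indeg [Fintype V] (edge : V → V → Prop) (v : V) : ℕ :=
  (Finset.univ.filter fun u => edge u v).card

/-- The edge relation is acyclic (the graph is a DAG). -/
def Acyclic (edge : V → V → Prop) : Prop :=
  ∀ v, ¬ Relation.TransGen edge v v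

/-- The optimal cost of a valid pebbling with `R` red pebbles in the oneshot model. -/
noncomputable def optCost [Fintype V] [DecidableEq V] (edge : V → V → Prop) (R : ℕ) : ℕ :=
  sInf {c | ∃ moves : List (Move V),
    IsPebbling edge R moves ∧ Oneshot moves ∧ cost moves = c}

theorem computeCount_eq_sum [Fintype V] [DecidableEq V] (ms : List (Move V)) :
    computeCount ms = ∑ v, ms.count (Move.compute v) := by
  induction ms with
  | nil => simp [computeCount]
  | cons m ms ih =>
    unfold computeCount at ih ⊢
    cases m <;> simp [isCompute, List.filter_cons, List.count_cons, Finset.sum_add_distrib, ih]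

theorem deleteCount_eq_sum [Fintype V] [DecidableEq V] (ms : List (Move V)) :
    deleteCount ms = ∑ v, ms.count (Move.delete v) := by
  induction ms with
  | nil => simp [deleteCount]
  | cons m ms ih =>
    unfold deleteCount at ih ⊢
    cases m <;> simp [isDelete, List.filter_cons, List.count_cons, Finset.sum_add_distrib, ih]

theorem length_eq_counts (ms : List (Move V)) :
    ms.length = computeCount ms + deleteCount ms + cost ms := by
  induction ms with
  | nil => simp [computeCount, deleteCount, cost]
  | cons m ms ih =>
    unfold computeCount deleteCount cost at ih ⊢
    cases m <;> simp [isCompute, isDelete, isTransfer, List.filter_cons, ih] <;> omega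

theorem applyMove_toRed_apply [DecidableEq V] (c : Config V) (v u : V) :
    applyMove c (Move.toRed v) u = if u = v then some Peb.red else c u :=
  Function.update_apply _ _ _ _

theorem applyMove_toBlue_apply [DecidableEq V] (c : Config V) (v u : V) :
    applyMove c (Move.toBlue v) u = if u = v then some Peb.blue else c u :=
  Function.update_apply _ _ _ _

theorem applyMove_compute_apply [DecidableEq V] (c : Config V) (v u : V) :
    applyMove c (Move.compute v) u = if u = v then some Peb.red else c u :=
  Function.update_apply _ _ _ _

theorem applyMove_delete_apply [DecidableEq V] (c : Config V) (v u : V) :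
    applyMove c (Move.delete v) u = if u = v then none else c u :=
  Function.update_apply _ _ _ _

/-- Every deletion at `v` removes a pebble that was initially there or was computed. -/
theorem count_delete_le [Fintype V] [DecidableEq V] {edge : V → V → Prop} {R : ℕ} (v : V)
    (ms : List (Move V)) (c : Config V) (h : ValidFrom edge R c ms) :
    ms.count (Move.delete v) ≤ ms.count (Move.compute v) + if c v = none then 0 else 1 := by
  induction ms generalizing c with
  | nil => simp
  | cons m ms ih =>
    obtain ⟨hl, -, hv⟩ := h
    have := ih _ hv
    cases m with
    | toRed w | toBlue w | compute w | delete w =>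
      by_cases hw : w = v
      · subst hw
        simp only [applyMove_toRed_apply, applyMove_toBlue_apply, applyMove_compute_apply,
          applyMove_delete_apply, legalMove, List.count_cons] at *
        simp_all
        try omega
      · simpa [applyMove_toRed_apply, applyMove_toBlue_apply, applyMove_compute_apply,
          applyMove_delete_apply, List.count_cons, hw, Ne.symm hw] using this

theorem validFrom_append [Fintype V] [DecidableEq V] {edge : V → V → Prop} {R : ℕ}
    {ms ns : List (Move V)} {c : Config V} :
    ValidFrom edge R c (ms ++ ns) ↔
      ValidFrom edge R c ms ∧ ValidFrom edge R (runMoves c ms) ns := by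
  induction ms generalizing c with
  | nil => simp [ValidFrom, runMoves]
  | cons m ms ih => simp [ValidFrom, runMoves, ih, and_assoc]

theorem runMoves_append [DecidableEq V] (ms ns : List (Move V)) (c : Config V) :
    runMoves c (ms ++ ns) = runMoves (runMoves c ms) ns := by
  induction ms generalizing c with
  | nil => rfl
  | cons m ms ih => exact ih _

/-- The configuration with red pebbles on `T` and blue pebbles on `S \ T`. -/
def redBlueConfig [DecidableEq V] (T S : Finset V) : Config V := fun u =>
  if u ∈ T then some Peb.red else if u ∈ S then some Peb.blue else none

theorem redCount_redBlueConfig [Fintype V] [DecidableEq V] (T S : Finset V) :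
    redCount (redBlueConfig T S) = T.card := by
  unfold redCount redBlueConfig
  congr 1
  ext u
  simp only [Finset.mem_filter, Finset.mem_univ, true_and]
  split_ifs <;> simp_all

theorem load_list [Fintype V] [DecidableEq V] (edge : V → V → Prop) {R : ℕ} {S : Finset V}
    (l : List V) (T : Finset V) (hl : ∀ u ∈ l, u ∈ S ∧ u ∉ T) (hn : l.Nodup)
    (hR : T.card + l.length ≤ R) :
    ValidFrom edge R (redBlueConfig T S) (l.map Move.toRed) ∧
      runMoves (redBlueConfig T S) (l.map Move.toRed) = redBlueConfig (T ∪ l.toFinset) S := by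
  induction l generalizing T with
  | nil => simp [ValidFrom, runMoves]
  | cons a l ih =>
    obtain ⟨haS, haT⟩ := hl a (by simp)
    obtain ⟨hal, hn⟩ := List.nodup_cons.1 hn
    have hstep : applyMove (redBlueConfig T S) (Move.toRed a) = redBlueConfig (insert a T) S := by
      funext u
      by_cases hu : u = a <;> simp [applyMove_toRed_apply, redBlueConfig, hu]
    have hcard := Finset.card_insert_of_notMem haT
    rw [List.length_cons] at hR
    obtain ⟨hv, hr⟩ := ih (insert a T) (fun u hu => ⟨(hl u (by simp [hu])).1, by
      have := (hl u (by simp [hu])).2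
      have : u ≠ a := fun e => hal (e ▸ hu)
      simp_all⟩) hn (by omega)
    refine ⟨⟨by simp [legalMove, redBlueConfig, haS, haT], ?_, ?_⟩, ?_⟩
    · rw [hstep, redCount_redBlueConfig]; omega
    · rw [hstep]; exact hv
    · change runMoves (applyMove _ _) _ = _
      rw [hstep, List.toFinset_cons, Finset.union_insert, ← Finset.insert_union]; exact hr

theorem store_list [Fintype V] [DecidableEq V] (edge : V → V → Prop) {R : ℕ} {S : Finset V}
    (l : List V) (T : Finset V) (hl : ∀ u ∈ l, u ∈ T) (hn : l.Nodup) (hTS : T ⊆ S)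
    (hR : T.card ≤ R) :
    ValidFrom edge R (redBlueConfig T S) (l.map Move.toBlue) ∧
      runMoves (redBlueConfig T S) (l.map Move.toBlue) = redBlueConfig (T \ l.toFinset) S := by
  induction l generalizing T with
  | nil => simp [ValidFrom, runMoves]
  | cons a l ih =>
    have haT := hl a (by simp)
    have haS := hTS haT
    obtain ⟨hal, hn⟩ := List.nodup_cons.1 hn
    have hstep : applyMove (redBlueConfig T S) (Move.toBlue a) = redBlueConfig (T.erase a) S := by
      funext u
      by_cases hu : u = a <;> simp [applyMove_toBlue_apply, redBlueConfig, hu, haS]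
    have hcard := Finset.card_erase_le (a := a) (s := T)
    obtain ⟨hv, hr⟩ := ih (T.erase a) (fun u hu => by
      have := hl u (by simp [hu])
      have : u ≠ a := fun e => hal (e ▸ hu)
      simp_all) hn ((Finset.erase_subset _ _).trans hTS) (by omega)
    refine ⟨⟨by simp [legalMove, redBlueConfig, haT], ?_, ?_⟩, ?_⟩
    · rw [hstep, redCount_redBlueConfig]; omega
    · rw [hstep]; exact hv
    · change runMoves (applyMove _ _) _ = _
      rw [hstep, hr, List.toFinset_cons, Finset.sdiff_insert, Finset.erase_sdiff_comm]

/-- Load the in-neighbours of `v`, compute `v`, and store everything again. -/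
theorem exists_moves_insert [Fintype V] [DecidableEq V] {edge : V → V → Prop} {Δ R : ℕ}
    (hΔ : ∀ v, indeg edge v ≤ Δ) (hR : Δ + 1 ≤ R) {S : Finset V} {v : V} (hv : v ∉ S)
    (hpred : ∀ u, edge u v → u ∈ S) :
    ∃ ms : List (Move V), ValidFrom edge R (redBlueConfig ∅ S) ms ∧
      runMoves (redBlueConfig ∅ S) ms = redBlueConfig ∅ (insert v S) ∧
      cost ms ≤ 2 * Δ + 1 ∧
      ∀ u, ms.count (Move.compute u) = if u = v then 1 else 0 := by
  set P : Finset V := Finset.univ.filter fun u => edge u v with hP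
  have hPc : P.card ≤ Δ := hΔ v
  have hPS : P ⊆ S := fun u hu => hpred u (by simpa [hP] using hu)
  have hvP : v ∉ P := fun h => hv (hPS h)
  obtain ⟨hv₁, hr₁⟩ := load_list edge (R := R) (S := S) P.toList ∅
    (fun u hu => ⟨hPS (by simpa using hu), by simp⟩) P.nodup_toList (by simp; omega)
  obtain ⟨hv₂, hr₂⟩ := store_list edge (R := R) (S := insert v S) (v :: P.toList) (insert v P)
    (by simp) (List.nodup_cons.2 ⟨by simpa using hvP, P.nodup_toList⟩)
    (Finset.insert_subset_insert _ hPS) (by rw [Finset.card_insert_of_notMem hvP]; omega)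
  have hstep : applyMove (redBlueConfig P S) (Move.compute v) =
      redBlueConfig (insert v P) (insert v S) := by
    funext u
    by_cases hu : u = v <;> simp [applyMove_compute_apply, redBlueConfig, hu]
  simp only [Finset.toList_toFinset, Finset.empty_union, List.toFinset_cons,
    sdiff_self, Finset.bot_eq_empty] at hr₁ hr₂
  refine ⟨P.toList.map Move.toRed ++ Move.compute v :: (v :: P.toList).map Move.toBlue,
    ?_, ?_, ?_, ?_⟩
  · rw [validFrom_append, hr₁]
    refine ⟨hv₁, fun u hu => by simp [redBlueConfig, hP, hu], ?_, ?_⟩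
    · rw [hstep, redCount_redBlueConfig, Finset.card_insert_of_notMem hvP]; omega
    · rw [hstep]; exact hv₂
  · rw [runMoves_append, hr₁]
    change runMoves (applyMove _ _) _ = _
    rw [hstep, hr₂]
  · have h₁ : ∀ l : List V, cost (l.map Move.toRed) = l.length := fun l => by
      simp [cost, List.filter_map, Function.comp_def, isTransfer]
    have h₂ : ∀ l : List V, cost (l.map Move.toBlue) = l.length := fun l => by
      simp [cost, List.filter_map, Function.comp_def, isTransfer]
    have h₃ := h₁ P.toList
    have h₄ := h₂ (v :: P.toList)
    unfold cost at h₃ h₄ ⊢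
    rw [List.filter_append, List.length_append, h₃, List.filter_cons_of_neg (by simp [isTransfer]),
      h₄]
    simp
    omega
  · intro u
    have h₁ : ∀ l : List V, (l.map Move.toRed).count (Move.compute u) = 0 := fun l =>
      List.count_eq_zero.2 (by simp)
    have h₂ : ∀ l : List V, (l.map Move.toBlue).count (Move.compute u) = 0 := fun l =>
      List.count_eq_zero.2 (by simp)
    rw [List.count_append, List.count_cons, h₁, h₂]
    simp [@eq_comm _ v u]

theorem Acyclic.wellFounded [Finite V] {edge : V → V → Prop} (h : Acyclic edge) :
    WellFounded edge := by
  have : Std.Irrefl (Relation.TransGen edge) := ⟨h⟩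
  exact Subrelation.wf (fun h => Relation.TransGen.single h)
    (Finite.wellFounded_of_trans_of_irrefl (Relation.TransGen edge))

/-- Computing the nodes in topological order, one can pebble a predecessor-closed set of any
size at cost at most `2Δ + 1` per node. -/
theorem exists_moves_card [Fintype V] [DecidableEq V] {edge : V → V → Prop}
    (hacyc : Acyclic edge) {Δ R : ℕ} (hΔ : ∀ v, indeg edge v ≤ Δ) (hR : Δ + 1 ≤ R)
    (k : ℕ) (hk : k ≤ Fintype.card V) :
    ∃ (S : Finset V) (ms : List (Move V)), S.card = k ∧
      ValidFrom edge R initConfig ms ∧ runMoves initConfig ms = redBlueConfig ∅ S ∧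
      cost ms ≤ (2 * Δ + 1) * k ∧
      ∀ u, ms.count (Move.compute u) = if u ∈ S then 1 else 0 := by
  induction k with
  | zero =>
    exact ⟨∅, [], rfl, trivial, by simp [runMoves]; rfl, by simp [cost], by simp⟩
  | succ k ih =>
    obtain ⟨S, ms, hS, hv, hr, hc, hcount⟩ := ih (by omega)
    obtain ⟨w, hw⟩ : ∃ w, w ∉ S := by
      by_contra! h
      have := Finset.card_eq_iff_eq_univ S |>.2 (Finset.eq_univ_of_forall h)
      omega
    obtain ⟨v, hvS, hmin⟩ := hacyc.wellFounded.has_min {u | u ∉ S} ⟨w, hw⟩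
    obtain ⟨ns, hv', hr', hc', hcount'⟩ := exists_moves_insert hΔ hR hvS
      (fun u hu => by by_contra h; exact hmin u h hu)
    refine ⟨insert v S, ms ++ ns, by rw [Finset.card_insert_of_notMem hvS, hS], ?_, ?_, ?_, ?_⟩
    · rw [validFrom_append, hr]; exact ⟨hv, hv'⟩
    · rw [runMoves_append, hr, hr']
    · have : cost (ms ++ ns) = cost ms + cost ns := by simp [cost]
      rw [this, mul_add_one]; omega
    · intro u
      rw [List.count_append, hcount, hcount']
      by_cases hu : u = v
      · subst hu; simp [show u ∉ S from hvS]
      · simp [hu]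

theorem exists_oneshot_pebbling [Fintype V] [DecidableEq V] {edge : V → V → Prop}
    (hacyc : Acyclic edge) {Δ R : ℕ} (hΔ : ∀ v, indeg edge v ≤ Δ) (hR : Δ + 1 ≤ R) :
    ∃ ms : List (Move V), IsPebbling edge R ms ∧ Oneshot ms ∧
      cost ms ≤ (2 * Δ + 1) * Fintype.card V := by
  obtain ⟨S, ms, hS, hv, hr, hc, hcount⟩ := exists_moves_card hacyc hΔ hR _ le_rfl
  obtain rfl := (Finset.card_eq_iff_eq_univ S).1 hS
  exact ⟨ms, ⟨hv, fun v _ => by simp [hr, redBlueConfig]⟩, fun v => by simp [hcount], hc⟩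

/-- In the oneshot model with `R ≥ Δ + 1`, every minimum-cost valid
pebbling with `R` red pebbles has at most `n` compute moves, at most `n` delete
moves, at most `(2Δ + 1)·n` transfer moves, and hence at most `(2Δ + 3)·n` moves
in total. -/
theorem oneshot_optimal_length_bound
    {V : Type} [Fintype V] [DecidableEq V] (edge : V → V → Prop)
    (hacyc : Acyclic edge) (Δ R : ℕ)
    (hΔ : ∀ v, indeg edge v ≤ Δ) (hR : Δ + 1 ≤ R)
    (moves : List (Move V))
    (hpeb : IsPebbling edge R moves) (hone : Oneshot moves)
    (hopt : ∀ moves' : List (Move V),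
      IsPebbling edge R moves' → Oneshot moves' → cost moves ≤ cost moves') :
    computeCount moves ≤ Fintype.card V ∧
    deleteCount moves ≤ Fintype.card V ∧
    cost moves ≤ (2 * Δ + 1) * Fintype.card V ∧
    moves.length ≤ (2 * Δ + 3) * Fintype.card V := by
  have hcomp : computeCount moves ≤ Fintype.card V := by
    rw [computeCount_eq_sum]
    exact (Finset.sum_le_sum fun v _ => hone v).trans (by simp)
  have hdel : deleteCount moves ≤ Fintype.card V := by
    rw [deleteCount_eq_sum]
    refine (Finset.sum_le_sum fun v _ => ?_).trans (Finset.card_eq_sum_ones Finset.univ).ge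
    have := count_delete_le v moves initConfig hpeb.1
    rw [if_pos (by rfl)] at this
    exact this.trans (hone v)
  obtain ⟨ms, hms, hms₁, hcost⟩ := exists_oneshot_pebbling hacyc hΔ hR
  have hc := (hopt ms hms hms₁).trans hcost
  refine ⟨hcomp, hdel, hc, ?_⟩
  rw [length_eq_counts]
  linarith

end RBPebble
end

section
/- Let R ≥ 4 and let G be a finite DAG containing pairwise distinct nodes u_1, u_2, u_3, a node v, and a set B of R − 1 further nodes, such that the in-neighbor set of each of u_1, u_2, u_3 is exactly B, the in-neighbor set of v is exactly {u_1, u_2, u_3}, and v is a sink or has a directed path to a sink of G. Then every valid pebbling of G with R red pebbles, in the base model as well as in the oneshot model, has cost at least 4 (i.e., it uses at least 4 moves of types (1) and (2)). -/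
namespace RBPebble

open scoped Classical

variable {V : Type}

/-- The weight of the pebble of a starter node: the number of transfers needed to turn it red
when the node itself is not computed any more (an empty node counts a round trip). -/
def pebbleWeight : Option Peb → ℕ
  | none => 2
  | some .blue => 1
  | some .red => 0

/-- A lower bound on the number of transfers needed to have red pebbles on three starter nodes
carrying `a`, `b` and `c`: the total weight, where the heaviest node is free if none is red. -/
def starterPotential (a b c : Option Peb) : ℕ :=
  if a = some .red ∨ b = some .red ∨ c = some .red then
    pebbleWeight a + pebbleWeight b + pebbleWeight c
  else
    pebbleWeight a + pebbleWeight b + pebbleWeight c -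
      max (pebbleWeight a) (max (pebbleWeight b) (pebbleWeight c))

theorem starterPotential_swap_left (a b c : Option Peb) :
    starterPotential a b c = starterPotential b a c := by
  rcases a with _ | _ | _ <;> rcases b with _ | _ | _ <;> rcases c with _ | _ | _ <;>
    simp [starterPotential, pebbleWeight]

theorem starterPotential_rotate (a b c : Option Peb) :
    starterPotential a b c = starterPotential c a b := by
  rcases a with _ | _ | _ <;> rcases b with _ | _ | _ <;> rcases c with _ | _ | _ <;>
    simp [starterPotential, pebbleWeight]

theorem starterPotential_blue_le (b c : Option Peb) :
    starterPotential (some .blue) b c ≤ starterPotential (some .red) b c + 1 := by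
  rcases b with _ | _ | _ <;> rcases c with _ | _ | _ <;>
    simp [starterPotential, pebbleWeight]

theorem starterPotential_red_le (b c : Option Peb) :
    starterPotential (some .red) b c ≤ starterPotential (some .blue) b c + 1 := by
  rcases b with _ | _ | _ <;> rcases c with _ | _ | _ <;>
    simp [starterPotential, pebbleWeight]

theorem starterPotential_le_none (a b c : Option Peb) :
    starterPotential a b c ≤ starterPotential none b c := by
  rcases a with _ | _ | _ <;> rcases b with _ | _ | _ <;> rcases c with _ | _ | _ <;>
    simp [starterPotential, pebbleWeight]

theorem starterPotential_le_red (a b c : Option Peb) (hb : b ≠ some .red) (hc : c ≠ some .red) :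
    starterPotential a b c ≤ starterPotential (some .red) b c := by
  rcases a with _ | _ | _ <;> rcases b with _ | _ | _ <;> rcases c with _ | _ | _ <;>
    simp_all [starterPotential, pebbleWeight]

/-- The node a move acts on. -/
def Move.node : Move V → V
  | .toRed v => v
  | .toBlue v => v
  | .compute v => v
  | .delete v => v

theorem applyMove_of_ne [DecidableEq V] (c : Config V) (m : Move V) {w : V} (h : w ≠ m.node) :
    applyMove c m w = c w := by
  cases m <;> exact Function.update_of_ne h _ _

theorem cost_cons (m : Move V) (ms : List (Move V)) :
    cost (m :: ms) = cost [m] + cost ms := by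
  cases m <;> simp [cost, isTransfer, List.filter_cons, Nat.add_comm]

theorem eq_compute_of_node_reachable {edge : V → V → Prop} {c : Config V}
    {m : Move V} {v : V}
    (hempty : ∀ w, Relation.ReflTransGen edge v w → c w = none) (hlegal : legalMove edge c m)
    (hm : Relation.ReflTransGen edge v m.node) : m = .compute v := by
  have hnone := hempty _ hm
  cases m with
  | toRed x => exact absurd (hnone.symm.trans hlegal) (by simp)
  | toBlue x => exact absurd (hnone.symm.trans hlegal) (by simp)
  | delete x => exact absurd hnone hlegal
  | compute x =>
    rcases Relation.ReflTransGen.cases_tail hm with h | ⟨y, hvy, hyx⟩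
    · exact congrArg Move.compute h
    · exact absurd ((hempty y hvy).symm.trans (hlegal y hyx)) (by simp)

section

variable [Fintype V] [DecidableEq V] {edge : V → V → Prop} {R : ℕ} {B : Finset V} {c : Config V}

/-- Right after computing a node with `R - 1` in-neighbors, only this node and its in-neighbors
are red. -/
theorem not_red_of_compute {x y : V} (hR : 1 ≤ R) (hcard : B.card = R - 1)
    (hx : x ∉ B) (hy : y ∉ B) (hyx : y ≠ x) (hin : ∀ w, edge w x ↔ w ∈ B)
    (hlegal : legalMove edge c (.compute x))
    (hred : redCount (applyMove c (.compute x)) ≤ R) : c y ≠ some .red := by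
  intro hyr
  have hsub : insert y (insert x B) ⊆
      Finset.univ.filter fun w => applyMove c (.compute x) w = some Peb.red := by
    intro w hw
    rw [Finset.mem_filter]
    refine ⟨Finset.mem_univ _, ?_⟩
    by_cases hwx : w = x
    · subst hwx
      exact Function.update_self _ _ _
    · rw [applyMove_of_ne c (.compute x) hwx]
      rcases Finset.mem_insert.1 hw with rfl | hw
      · exact hyr
      · exact hlegal w ((hin w).2 ((Finset.mem_insert.1 hw).resolve_left hwx))
  have hle := (Finset.card_le_card hsub).trans hred
  rw [Finset.card_insert_of_notMem (by simp [hyx, hy]), Finset.card_insert_of_notMem hx] at hle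
  omega

theorem starterPotential_le_of_node_eq {m : Move V} {x y z : V} (hR : 1 ≤ R)
    (hcard : B.card = R - 1) (hx : x ∉ B) (hy : y ∉ B) (hz : z ∉ B) (hyx : y ≠ x) (hzx : z ≠ x)
    (hin : ∀ w, edge w x ↔ w ∈ B) (hlegal : legalMove edge c m)
    (hred : redCount (applyMove c m) ≤ R) (hm : m.node = x) :
    starterPotential (c x) (c y) (c z) ≤
      starterPotential (applyMove c m x) (applyMove c m y) (applyMove c m z) + cost [m] := by
  subst hm
  rw [applyMove_of_ne c m hyx, applyMove_of_ne c m hzx]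
  cases m with
  | toRed x =>
    have h : c x = some .blue := hlegal
    have h' : applyMove c (.toRed x) x = some .red := Function.update_self _ _ _
    simp only [Move.node, h, h']
    exact starterPotential_blue_le (c y) (c z)
  | toBlue x =>
    have h : c x = some .red := hlegal
    have h' : applyMove c (.toBlue x) x = some .blue := Function.update_self _ _ _
    simp only [Move.node, h, h']
    exact starterPotential_red_le (c y) (c z)
  | compute x =>
    have h' : applyMove c (.compute x) x = some .red := Function.update_self _ _ _
    simp only [Move.node, h']
    exact starterPotential_le_red (c x) (c y) (c z)
      (not_red_of_compute hR hcard hx hy hyx hin hlegal hred)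
      (not_red_of_compute hR hcard hx hz hzx hin hlegal hred)
  | delete x =>
    have h' : applyMove c (.delete x) x = none := Function.update_self _ _ _
    simp only [Move.node, h']
    exact starterPotential_le_none (c x) (c y) (c z)

/-- A legal move lowers the potential of the starter nodes by at most its cost. -/
theorem starterPotential_le_applyMove {m : Move V} {u₁ u₂ u₃ : V} (hR : 1 ≤ R)
    (hcard : B.card = R - 1) (h12 : u₁ ≠ u₂) (h13 : u₁ ≠ u₃) (h23 : u₂ ≠ u₃)
    (hu₁B : u₁ ∉ B) (hu₂B : u₂ ∉ B) (hu₃B : u₃ ∉ B)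
    (hin₁ : ∀ w, edge w u₁ ↔ w ∈ B) (hin₂ : ∀ w, edge w u₂ ↔ w ∈ B)
    (hin₃ : ∀ w, edge w u₃ ↔ w ∈ B) (hlegal : legalMove edge c m)
    (hred : redCount (applyMove c m) ≤ R) :
    starterPotential (c u₁) (c u₂) (c u₃) ≤
      starterPotential (applyMove c m u₁) (applyMove c m u₂) (applyMove c m u₃) + cost [m] := by
  by_cases hm₁ : m.node = u₁
  · exact starterPotential_le_of_node_eq hR hcard hu₁B hu₂B hu₃B h12.symm h13.symm hin₁ hlegal
      hred hm₁
  by_cases hm₂ : m.node = u₂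
  · rw [starterPotential_swap_left (c u₁), starterPotential_swap_left (applyMove c m u₁)]
    exact starterPotential_le_of_node_eq hR hcard hu₂B hu₁B hu₃B h12 h23.symm hin₂ hlegal hred hm₂
  by_cases hm₃ : m.node = u₃
  · rw [starterPotential_rotate (c u₁), starterPotential_rotate (applyMove c m u₁)]
    exact starterPotential_le_of_node_eq hR hcard hu₃B hu₁B hu₂B h13 h23 hin₃ hlegal hred hm₃
  rw [applyMove_of_ne c m (Ne.symm hm₁), applyMove_of_ne c m (Ne.symm hm₂),
    applyMove_of_ne c m (Ne.symm hm₃)]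
  exact Nat.le_add_right _ _

/-- Starting with no pebble on `v` and its descendants, the pebbling of one of these costs at
least the potential of the starter nodes. -/
theorem starterPotential_le_cost {u₁ u₂ u₃ v s : V} (hR : 1 ≤ R)
    (hcard : B.card = R - 1) (h12 : u₁ ≠ u₂) (h13 : u₁ ≠ u₃) (h23 : u₂ ≠ u₃)
    (hu₁B : u₁ ∉ B) (hu₂B : u₂ ∉ B) (hu₃B : u₃ ∉ B)
    (hin₁ : ∀ w, edge w u₁ ↔ w ∈ B) (hin₂ : ∀ w, edge w u₂ ↔ w ∈ B)
    (hin₃ : ∀ w, edge w u₃ ↔ w ∈ B)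
    (hinv : ∀ w, edge w v ↔ (w = u₁ ∨ w = u₂ ∨ w = u₃))
    (hvs : Relation.ReflTransGen edge v s) (moves : List (Move V)) (c : Config V)
    (hempty : ∀ w, Relation.ReflTransGen edge v w → c w = none)
    (hvalid : ValidFrom edge R c moves) (hs : runMoves c moves s ≠ none) :
    starterPotential (c u₁) (c u₂) (c u₃) ≤ cost moves := by
  induction moves generalizing c with
  | nil => exact absurd (hempty s hvs) hs
  | cons m ms ih =>
    obtain ⟨hlegal, hred, hvalid⟩ := hvalid
    by_cases hm : Relation.ReflTransGen edge v m.node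
    · obtain rfl := eq_compute_of_node_reachable hempty hlegal hm
      have h₁ : c u₁ = some .red := hlegal u₁ ((hinv u₁).2 (by simp))
      have h₂ : c u₂ = some .red := hlegal u₂ ((hinv u₂).2 (by simp))
      have h₃ : c u₃ = some .red := hlegal u₃ ((hinv u₃).2 (by simp))
      simp [h₁, h₂, h₃, starterPotential, pebbleWeight]
    · have hstep := starterPotential_le_applyMove hR hcard h12 h13 h23 hu₁B hu₂B hu₃B
        hin₁ hin₂ hin₃ hlegal hred
      have hrest := ih (applyMove c m) (fun w hw => by
        rw [applyMove_of_ne c m (fun h => hm (h ▸ hw)), hempty w hw]) hvalid hs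
      rw [cost_cons]
      omega

end

/-- (H2C gadget lower bound.) Let `R ≥ 4` and suppose the DAG
contains pairwise distinct starter nodes `u₁, u₂, u₃`, a node `v`, and a set
`B` of `R − 1` further nodes such that the in-neighbor set of each `uᵢ` is
exactly `B`, the in-neighbor set of `v` is exactly `{u₁, u₂, u₃}`, and `v` is a
sink or has a directed path to a sink. Then every valid pebbling with `R` red
pebbles (in the base model, hence in particular in the oneshot model) has cost
at least 4. -/
theorem h2c_gadget_cost_lower_bound
    {V : Type} [Fintype V] [DecidableEq V] (edge : V → V → Prop)
    (hacyc : Acyclic edge) (R : ℕ) (hR : 4 ≤ R)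
    (u₁ u₂ u₃ v : V) (B : Finset V)
    (hcard : B.card = R - 1)
    (h12 : u₁ ≠ u₂) (h13 : u₁ ≠ u₃) (h23 : u₂ ≠ u₃)
    (hu₁B : u₁ ∉ B) (hu₂B : u₂ ∉ B) (hu₃B : u₃ ∉ B) (hvB : v ∉ B)
    (hv1 : v ≠ u₁) (hv2 : v ≠ u₂) (hv3 : v ≠ u₃)
    (hin₁ : ∀ w, edge w u₁ ↔ w ∈ B)
    (hin₂ : ∀ w, edge w u₂ ↔ w ∈ B)
    (hin₃ : ∀ w, edge w u₃ ↔ w ∈ B)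
    (hinv : ∀ w, edge w v ↔ (w = u₁ ∨ w = u₂ ∨ w = u₃))
    (hsink : ∃ s, IsSink edge s ∧ Relation.ReflTransGen edge v s)
    (moves : List (Move V)) (hpeb : IsPebbling edge R moves) :
    4 ≤ cost moves := by
  obtain ⟨s, hs, hvs⟩ := hsink
  have h := starterPotential_le_cost (by omega) hcard h12 h13 h23 hu₁B hu₂B hu₃B hin₁ hin₂ hin₃
    hinv hvs moves initConfig (fun _ _ => rfl) hpeb.1 (hpeb.2 s hs)
  simpa [initConfig, starterPotential, pebbleWeight] using h

end RBPebble
end
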